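/- A real number q > 1 belongs to the closure of the set U of univoque numbers if and only if the number 1 has a unique infinite expansion in base q, i.e., there is exactly one expansion (c_i) of 1 in base q having infinitely many nonzero terms. -/

import Mathlib

open Classical

noncomputable section

/-- The largest digit in base `q`: `α₁ = ⌈q⌉ - 1`. -/
def alphaOne (q : ℝ) : ℕ := (⌈q⌉ - 1).toNat

/-- `c` (0-indexed: `c i` is the digit `c_{i+1}` of the paper) is an expansion of `x`
in base `q`: all digits lie in `{0, …, α₁}` and `x = ∑_{i≥1} c_i q^{-i}`. -/
def IsExpansionOf (q x : ℝ) (c : ℕ → ℕ) : Prop :=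
  (∀ i, c i ≤ alphaOne q) ∧ x = ∑' i, (c i : ℝ) / q ^ (i + 1)

/-- A sequence is called infinite if it has infinitely many nonzero terms. -/
def InfiniteSeq (c : ℕ → ℕ) : Prop := {i | c i ≠ 0}.Infinite

/-- Strict lexicographic order on sequences. -/
def LexLt (a b : ℕ → ℕ) : Prop := ∃ n, (∀ i, i < n → a i = b i) ∧ a n < b n

/-- Lexicographic order `≤` on sequences. -/
def LexLe (a b : ℕ → ℕ) : Prop := LexLt a b ∨ a = b

/-- `b` is the greedy (lexicographically largest) expansion of `x` in base `q`. -/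
def IsGreedyOf (q x : ℝ) (b : ℕ → ℕ) : Prop :=
  IsExpansionOf q x b ∧ ∀ c, IsExpansionOf q x c → LexLe c b

/-- `a` is the quasi-greedy (lexicographically largest infinite) expansion of `x`
in base `q`. -/
def IsQuasiGreedyOf (q x : ℝ) (a : ℕ → ℕ) : Prop :=
  IsExpansionOf q x a ∧ InfiniteSeq a ∧
    ∀ c, IsExpansionOf q x c → InfiniteSeq c → LexLe c a

/-- The quasi-greedy expansion of `x` in base `q`; by convention it is the zero
sequence whenever no infinite expansion exists (in particular for `x = 0`). -/
def quasiGreedy (q x : ℝ) : ℕ → ℕ :=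
  if h : ∃ a, IsQuasiGreedyOf q x a then h.choose else fun _ => 0

/-- The greedy expansion of `x` in base `q` (zero sequence if `x` has no expansion). -/
def greedy (q x : ℝ) : ℕ → ℕ :=
  if h : ∃ b, IsGreedyOf q x b then h.choose else fun _ => 0

/-- The interval `J_q = [0, α₁/(q-1)]`. -/
def Jq (q : ℝ) : Set ℝ := Set.Icc 0 ((alphaOne q : ℝ) / (q - 1))

/-- `U_q`: the set of real numbers having exactly one expansion in base `q`. -/
def Uq (q : ℝ) : Set ℝ := {x | ∃! c, IsExpansionOf q x c}

/-- `U_q'`: the set of univoque sequences in base `q`. -/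
def UqSeq (q : ℝ) : Set (ℕ → ℕ) := {c | ∃ x ∈ Uq q, IsExpansionOf q x c}

/-- `U`: the set of univoque numbers. -/
def USet : Set ℝ := {q | 1 < q ∧ ∃! c, IsExpansionOf q 1 c}

/-- `V_q`: the set of `x ∈ J_q` such that for every `n ≥ 1` with `a_n(x) > 0` the
conjugated shifted quasi-greedy expansion is lexicographically at most `(α_i)`. -/
def Vq (q : ℝ) : Set ℝ :=
  {x | x ∈ Jq q ∧ ∀ n, 0 < quasiGreedy q x n →
    LexLe (fun i => alphaOne q - quasiGreedy q x (n + 1 + i)) (quasiGreedy q 1)}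

/-- `V`: the set of `q > 1` whose quasi-greedy expansion `(α_i)` of `1` satisfies
`(α₁ - α_{k+i})_{i≥1} ≤ (α_i)_{i≥1}` lexicographically for all `k ≥ 1`. -/
def VSet : Set ℝ :=
  {q | 1 < q ∧ ∀ k, LexLe (fun i => alphaOne q - quasiGreedy q 1 (k + 1 + i)) (quasiGreedy q 1)}

/-- The value of the digit sequence `c` in base `p`. -/
def seqVal (p : ℝ) (c : ℕ → ℕ) : ℝ := ∑' i, (c i : ℝ) / p ^ (i + 1)

lemma hasSum_const_div_pow {p : ℝ} (hp : 1 < p) (x : ℝ) :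
    HasSum (fun i : ℕ => x / p ^ (i + 1)) (x / (p - 1)) := by
  have hp0 : 0 < p := by linarith
  have h := (hasSum_geometric_of_lt_one (inv_nonneg.2 hp0.le) (inv_lt_one_of_one_lt₀ hp)).mul_left
    (x / p)
  have hp1 : p - 1 ≠ 0 := by linarith
  have hv : x / (p - 1) = x / p * (1 - p⁻¹)⁻¹ := by
    have : 1 - p⁻¹ ≠ 0 := by
      have := inv_lt_one_of_one_lt₀ hp
      linarith
    field_simp
  rw [hv]
  refine h.congr_fun fun i => ?_
  rw [inv_pow, pow_succ]
  field_simp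

section Values

variable {p : ℝ} {N : ℕ} {c d : ℕ → ℕ}

lemma summable_digits (hp : 1 < p) (hc : ∀ i, c i ≤ N) :
    Summable fun i => (c i : ℝ) / p ^ (i + 1) := by
  have hp0 : 0 < p := by linarith
  refine Summable.of_nonneg_of_le (fun i => by positivity) (fun i => ?_)
    (hasSum_const_div_pow hp N).summable
  have : (c i : ℝ) ≤ N := by exact_mod_cast hc i
  gcongr

lemma seqVal_nonneg (hp : 1 < p) : 0 ≤ seqVal p c := by
  have hp0 : 0 < p := by linarith
  exact tsum_nonneg fun i => by positivity

lemma seqVal_pos (hp : 1 < p) (hc : ∀ i, c i ≤ N) (h : ∃ i, c i ≠ 0) : 0 < seqVal p c := by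
  have hp0 : 0 < p := by linarith
  obtain ⟨i, hi⟩ := h
  have hi' : (0 : ℝ) < c i := by exact_mod_cast Nat.pos_of_ne_zero hi
  exact (summable_digits hp hc).tsum_pos (fun i => by positivity) i (by positivity)

lemma seqVal_compl (hp : 1 < p) (hc : ∀ i, c i ≤ N) :
    seqVal p (fun i => N - c i) = N / (p - 1) - seqVal p c := by
  have h := (hasSum_const_div_pow hp (N : ℝ)).sub (summable_digits hp hc).hasSum
  refine Eq.trans ?_ h.tsum_eq
  refine tsum_congr fun i => ?_
  rw [Nat.cast_sub (hc i), sub_div]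

lemma seqVal_le (hp : 1 < p) (hc : ∀ i, c i ≤ N) : seqVal p c ≤ N / (p - 1) := by
  have h := seqVal_compl hp hc
  have := seqVal_nonneg (c := fun i => N - c i) hp
  linarith

lemma seqVal_lt (hp : 1 < p) (hc : ∀ i, c i ≤ N) (h : ∃ i, c i ≠ N) :
    seqVal p c < N / (p - 1) := by
  have h1 := seqVal_compl hp hc
  have := seqVal_pos (N := N) (c := fun i => N - c i) hp (fun i => Nat.sub_le _ _)
    (h.imp fun i hi => by have := hc i; omega)
  linarith

lemma seqVal_split (hp : 1 < p) (hc : ∀ i, c i ≤ N) (n : ℕ) :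
    seqVal p c = ∑ i ∈ Finset.range n, (c i : ℝ) / p ^ (i + 1)
      + seqVal p (fun i => c (n + i)) / p ^ n := by
  have hp0 : 0 < p := by linarith
  rw [seqVal, ← (summable_digits hp hc).sum_add_tsum_nat_add n, seqVal, ← tsum_div_const]
  congr 1
  refine tsum_congr fun i => ?_
  rw [div_div, ← pow_add, add_comm i n, show n + i + 1 = i + 1 + n by ring]

lemma seqVal_sub_of_agree (hp : 1 < p) (hc : ∀ i, c i ≤ N) (hd : ∀ i, d i ≤ N) {n : ℕ}
    (h : ∀ i < n, c i = d i) :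
    p ^ (n + 1) * (seqVal p c - seqVal p d) =
      (c n - d n : ℝ) + seqVal p (fun i => c (n + 1 + i)) - seqVal p (fun i => d (n + 1 + i)) := by
  have hp0 : 0 < p := by linarith
  rw [seqVal_split hp hc (n + 1), seqVal_split hp hd (n + 1), Finset.sum_range_succ,
    Finset.sum_range_succ, Finset.sum_congr rfl fun i hi => by rw [h i (Finset.mem_range.1 hi)]]
  field_simp
  ring

lemma seqVal_tail (hp : 1 < p) (hc : ∀ i, c i ≤ N) (j : ℕ) :
    seqVal p (fun i => c (j + 1 + i)) = p * seqVal p (fun i => c (j + i)) - c j := by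
  have hp0 : 0 < p := by linarith
  rw [seqVal_split hp (fun i => hc (j + i)) 1]
  simp only [Finset.sum_range_one, add_zero, zero_add, pow_one, add_assoc]
  field_simp
  ring

/-- Digits produced by iterating a map `r ↦ p * r - d` that stays inside a bounded set. -/
lemma exists_digits_of_step {B : ℝ} {S : Set ℝ} (hp : 1 < p) (hS : ∀ r ∈ S, 0 ≤ r ∧ r ≤ B)
    (step : ∀ r ∈ S, ∃ d : ℕ, d ≤ N ∧ p * r - d ∈ S) {x : ℝ} (hx : x ∈ S) :
    ∃ c : ℕ → ℕ, (∀ i, c i ≤ N) ∧ seqVal p c = x ∧ ∀ j, seqVal p (fun i => c (j + i)) ∈ S := by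
  have hp0 : 0 < p := by linarith
  choose! d hdN hdS using step
  set T : ℝ → ℝ := fun r => p * r - d r with hT
  have hmem : ∀ j, ∀ x ∈ S, T^[j] x ∈ S := by
    intro j
    induction j with
    | zero => intro x hx; simpa
    | succ j ih => intro x hx; rw [Function.iterate_succ_apply']; exact hdS _ (ih x hx)
  have key : ∀ x ∈ S, seqVal p (fun i => d (T^[i] x)) = x := by
    intro x hx
    refine HasSum.tsum_eq ((hasSum_iff_tendsto_nat_of_nonneg (fun i => by positivity) _).2 ?_)
    have hpart : ∀ n, ∑ i ∈ Finset.range n, (d (T^[i] x) : ℝ) / p ^ (i + 1) =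
        x - T^[n] x / p ^ n := by
      intro n
      induction n with
      | zero => simp
      | succ n ih =>
        rw [Finset.sum_range_succ, ih, Function.iterate_succ_apply', hT]
        field_simp
        ring
    simp only [hpart]
    have h0 : Filter.Tendsto (fun n => T^[n] x / p ^ n) Filter.atTop (nhds 0) := by
      have hB : Filter.Tendsto (fun n : ℕ => B / p ^ n) Filter.atTop (nhds 0) :=
        tendsto_const_nhds.div_atTop (tendsto_pow_atTop_atTop_of_one_lt hp)
      refine squeeze_zero (fun n => ?_) (fun n => ?_) hB
      · exact div_nonneg (hS _ (hmem n x hx)).1 (by positivity)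
      · have := (hS _ (hmem n x hx)).2
        gcongr
    simpa using h0.const_sub x
  refine ⟨fun i => d (T^[i] x), fun i => hdN _ (hmem i x hx), key x hx, fun j => ?_⟩
  have h := key _ (hmem j x hx)
  simp only [← Function.iterate_add_apply] at h
  simp only [add_comm j]
  rw [h]
  exact hmem j x hx

lemma exists_digits (hp : 1 < p) (hpN : p ≤ N + 1) {x : ℝ} (h0 : 0 ≤ x)
    (hx : x ≤ N / (p - 1)) : ∃ c : ℕ → ℕ, (∀ i, c i ≤ N) ∧ seqVal p c = x := by
  have hp1 : 0 < p - 1 := by linarith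
  have h1 : 1 ≤ N / (p - 1) := by rw [le_div_iff₀ hp1]; linarith
  have step : ∀ r ∈ Set.Icc (0 : ℝ) (N / (p - 1)), ∃ d : ℕ, d ≤ N ∧
      p * r - d ∈ Set.Icc (0 : ℝ) (N / (p - 1)) := by
    rintro r ⟨hr0, hr⟩
    have hpr : 0 ≤ p * r := by positivity
    rcases le_total ⌊p * r⌋₊ N with h | h
    · refine ⟨_, h, ?_, ?_⟩
      · linarith [Nat.floor_le hpr]
      · linarith [Nat.lt_floor_add_one (p * r)]
    · refine ⟨N, le_rfl, ?_, ?_⟩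
      · have := (Nat.le_floor_iff hpr).1 h
        linarith
      · rw [le_div_iff₀ hp1] at hr ⊢
        nlinarith
  obtain ⟨c, hc, hv, -⟩ := exists_digits_of_step hp (fun r hr => hr) step ⟨h0, hx⟩
  exact ⟨c, hc, hv⟩

lemma exists_infinite_digits (hp : 1 < p) (hpN : p ≤ N + 1) {x : ℝ}
    (h0 : 0 < x) (hx : x ≤ N / (p - 1)) :
    ∃ c : ℕ → ℕ, (∀ i, c i ≤ N) ∧ seqVal p c = x ∧ ∀ j, ∃ i, c (j + i) ≠ 0 := by
  have hp1 : 0 < p - 1 := by linarith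
  have h1 : 1 ≤ N / (p - 1) := by rw [le_div_iff₀ hp1]; linarith
  have step : ∀ r ∈ Set.Ioc (0 : ℝ) (N / (p - 1)), ∃ d : ℕ, d ≤ N ∧
      p * r - d ∈ Set.Ioc (0 : ℝ) (N / (p - 1)) := by
    rintro r ⟨hr0, hr⟩
    have hpr : 0 < p * r := by positivity
    have hceil : 1 ≤ ⌈p * r⌉₊ := Nat.one_le_ceil_iff.2 hpr
    rcases le_total (⌈p * r⌉₊ - 1) N with h | h
    · refine ⟨_, h, ?_, ?_⟩
      · rw [Nat.cast_sub hceil]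
        push_cast
        linarith [Nat.ceil_lt_add_one hpr.le]
      · rw [Nat.cast_sub hceil]
        push_cast
        linarith [Nat.le_ceil (p * r)]
    · refine ⟨N, le_rfl, ?_, ?_⟩
      · have := Nat.lt_ceil.1 (show N < ⌈p * r⌉₊ by omega)
        linarith
      · rw [le_div_iff₀ hp1] at hr ⊢
        nlinarith
  obtain ⟨c, hc, hv, hpos⟩ := exists_digits_of_step hp (fun r hr => ⟨hr.1.le, hr.2⟩) step ⟨h0, hx⟩
  refine ⟨c, hc, hv, fun j => ?_⟩
  by_contra! h
  have := (hpos j).1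
  simp [seqVal, h] at this

end Values

lemma infiniteSeq_iff {c : ℕ → ℕ} : InfiniteSeq c ↔ ∀ j, ∃ i, c (j + i) ≠ 0 := by
  constructor
  · intro h j
    obtain ⟨i, hi, hj⟩ := h.exists_gt j
    exact ⟨i - j, by rwa [Nat.add_sub_cancel' hj.le]⟩
  · intro h
    refine Set.infinite_of_forall_exists_gt fun j => ?_
    obtain ⟨i, hi⟩ := h (j + 1)
    exact ⟨_, hi, by omega⟩

lemma alphaOne_bounds {q : ℝ} (hq : 1 < q) :
    1 ≤ alphaOne q ∧ (alphaOne q : ℝ) < q ∧ q ≤ alphaOne q + 1 := by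
  have h1 : 1 < ⌈q⌉ := Int.lt_ceil.2 (by exact_mod_cast hq)
  have h : ((alphaOne q : ℤ)) = ⌈q⌉ - 1 := Int.toNat_of_nonneg (by omega)
  have h' : (alphaOne q : ℝ) = ⌈q⌉ - 1 := by exact_mod_cast congrArg (Int.cast : ℤ → ℝ) h
  refine ⟨by omega, ?_, ?_⟩
  · linarith [Int.ceil_lt_add_one q]
  · linarith [Int.le_ceil q]

lemma alphaOne_eq {q : ℝ} {N : ℕ} (h1 : (N : ℝ) < q) (h2 : q ≤ N + 1) : alphaOne q = N := by
  have : ⌈q⌉ = N + 1 := Int.ceil_eq_iff.2 ⟨by push_cast; linarith, by push_cast; linarith⟩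
  rw [alphaOne, this]
  simp

lemma exists_infinite_expansion {q : ℝ} (hq : 1 < q) :
    ∃ c, IsExpansionOf q 1 c ∧ InfiniteSeq c := by
  obtain ⟨-, -, h3⟩ := alphaOne_bounds hq
  obtain ⟨c, hc, hv, hi⟩ := exists_infinite_digits (x := 1) hq h3 one_pos
    (by rw [le_div_iff₀ (by linarith)]; linarith)
  exact ⟨c, ⟨hc, hv.symm⟩, infiniteSeq_iff.2 hi⟩

lemma isExpansionOf_iff {q x : ℝ} {c : ℕ → ℕ} :
    IsExpansionOf q x c ↔ (∀ i, c i ≤ alphaOne q) ∧ seqVal q c = x :=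
  and_congr_right fun _ => eq_comm

lemma eq_const_of_seqVal_eq_one {q : ℝ} {N : ℕ} {c : ℕ → ℕ} (hq : 1 < q) (hqN : q = N + 1)
    (hc : ∀ i, c i ≤ N) (hv : seqVal q c = 1) : c = fun _ => N := by
  by_contra h
  have h' := seqVal_lt hq hc (Function.ne_iff.1 h)
  have hN : (N : ℝ) = q - 1 := by linarith
  rw [hv, hN, div_self (by linarith)] at h'
  exact h'.false

lemma exists_expansion_of_prefix {p : ℝ} {N n : ℕ} {c : ℕ → ℕ} (hN : 1 ≤ N) (h1 : (N : ℝ) < p)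
    (h2 : p ≤ N + 1) (hc : ∀ i, c i ≤ N)
    (hlow : ∑ i ∈ Finset.range n, (c i : ℝ) / p ^ (i + 1) ≤ 1)
    (hhigh : 1 ≤ ∑ i ∈ Finset.range n, (c i : ℝ) / p ^ (i + 1) + N / (p - 1) / p ^ n) :
    ∃ d, IsExpansionOf p 1 d ∧ ∀ i < n, d i = c i := by
  have hN' : (1 : ℝ) ≤ N := by exact_mod_cast hN
  have hp : 1 < p := by linarith
  have hpn : 0 < p ^ n := by positivity
  obtain ⟨e, he, hev⟩ := exists_digits hp h2
    (x := p ^ n * (1 - ∑ i ∈ Finset.range n, (c i : ℝ) / p ^ (i + 1)))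
    (mul_nonneg hpn.le (by linarith)) (by rw [mul_comm, ← le_div_iff₀ hpn]; linarith)
  have hd : ∀ i, (if i < n then c i else e (i - n)) ≤ N := by
    intro i
    split_ifs
    exacts [hc i, he _]
  refine ⟨fun i => if i < n then c i else e (i - n), isExpansionOf_iff.2 ⟨?_, ?_⟩, ?_⟩
  · rwa [alphaOne_eq h1 h2]
  · have htail : (fun i => if n + i < n then c (n + i) else e (n + i - n)) = e := by
      funext i
      simp
    rw [seqVal_split hp hd n, htail, hev, Finset.sum_congr rfl fun i hi => by
      rw [if_pos (Finset.mem_range.1 hi)]]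
    field_simp
    ring
  · intro i hi
    simp [hi]

/-- The sequence that follows `b` up to position `n`, where it has the digit `d`, and then `e`. -/
def splice (b : ℕ → ℕ) (n d : ℕ) (e : ℕ → ℕ) (i : ℕ) : ℕ :=
  if i < n then b i else if i = n then d else e (i - (n + 1))

section Splice

variable {b e : ℕ → ℕ} {n d i N : ℕ}

lemma splice_of_lt (h : i < n) : splice b n d e i = b i := if_pos h

lemma splice_self : splice b n d e n = d := by simp [splice]

lemma splice_tail (i : ℕ) : splice b n d e (n + 1 + i) = e i := by
  rw [splice, if_neg (by omega), if_neg (by omega), Nat.add_sub_cancel_left]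

lemma splice_le (hb : ∀ i, b i ≤ N) (hd : d ≤ N) (he : ∀ i, e i ≤ N) (i : ℕ) :
    splice b n d e i ≤ N := by
  unfold splice
  split_ifs
  exacts [hb i, hd, he _]

lemma seqVal_splice {q : ℝ} (hq : 1 < q) (hb : ∀ i, b i ≤ N) (hd : d ≤ N) (he : ∀ i, e i ≤ N)
    (h : d + seqVal q e = b n + seqVal q (fun i => b (n + 1 + i))) :
    seqVal q (splice b n d e) = seqVal q b := by
  have h' := seqVal_sub_of_agree hq (splice_le hb hd he) hb (n := n) fun i hi => splice_of_lt hi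
  rw [splice_self, funext splice_tail] at h'
  have h0 : q ^ (n + 1) ≠ 0 := by positivity
  have := (mul_eq_zero.1 (h'.trans (by linarith))).resolve_left h0
  linarith

lemma splice_infinite (he : ∀ j, ∃ i, e (j + i) ≠ 0) (j : ℕ) :
    ∃ i, splice b n d e (j + i) ≠ 0 := by
  obtain ⟨i, hi⟩ := he j
  refine ⟨n + 1 + i, ?_⟩
  rwa [show j + (n + 1 + i) = n + 1 + (j + i) by ring, splice_tail]

end Splice

section Perturbation

open Filter Topology

variable {q : ℝ} {N : ℕ} {c : ℕ → ℕ}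

lemma continuousAt_prefix_sum (hq : 0 < q) (c : ℕ → ℕ) (n : ℕ) :
    ContinuousAt (fun p : ℝ => ∑ i ∈ Finset.range n, (c i : ℝ) / p ^ (i + 1)) q :=
  tendsto_finsetSum _ fun i _ =>
    (continuousAt_const (y := (c i : ℝ))).div (continuousAt_id.pow (i + 1)) (by simp; positivity)

lemma continuousAt_max_tail (hq : 1 < q) (N n : ℕ) :
    ContinuousAt (fun p : ℝ => (N : ℝ) / (p - 1) / p ^ n) q := by
  have : q - 1 ≠ 0 := by linarith
  have : q ^ n ≠ 0 := by positivity
  exact (continuousAt_const.div (continuousAt_id.sub continuousAt_const) ‹_›).div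
    (continuousAt_id.pow n) ‹_›

lemma eventually_exists_prefix_left (hN : 1 ≤ N) (h1 : (N : ℝ) < q) (h2 : q < N + 1)
    (hc : ∀ i, c i ≤ N) (hv : seqVal q c = 1) (hinf : ∀ j, ∃ i, c (j + i) ≠ 0) (n : ℕ) :
    ∀ᶠ p in 𝓝 q, p ≤ q → ∃ d, IsExpansionOf p 1 d ∧ ∀ i < n, d i = c i := by
  have hN' : (1 : ℝ) ≤ N := by exact_mod_cast hN
  have hq : 1 < q := by linarith
  have hs := seqVal_split hq hc n
  have hpos := seqVal_pos hq (fun i => hc (n + i)) (hinf n)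
  have hle := seqVal_le hq (fun i => hc (n + i))
  have hlow : ∑ i ∈ Finset.range n, (c i : ℝ) / q ^ (i + 1) < 1 := by
    have : 0 < seqVal q (fun i => c (n + i)) / q ^ n := by positivity
    linarith
  have hhigh : 1 ≤ ∑ i ∈ Finset.range n, (c i : ℝ) / q ^ (i + 1) + N / (q - 1) / q ^ n := by
    have : seqVal q (fun i => c (n + i)) / q ^ n ≤ N / (q - 1) / q ^ n := by gcongr
    linarith
  filter_upwards [lt_mem_nhds h1, gt_mem_nhds h2,
    (continuousAt_prefix_sum (by linarith) c n).eventually_lt_const hlow] with p hp1 hp2 hp3 hpq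
  have hp0 : 0 < p - 1 := by linarith
  have hp0' : 0 < p := by linarith
  refine exists_expansion_of_prefix hN hp1 hp2.le hc hp3.le (hhigh.trans ?_)
  gcongr

lemma eventually_exists_prefix_right (hN : 1 ≤ N) (h1 : (N : ℝ) < q) (h2 : q < N + 1)
    (hc : ∀ i, c i ≤ N) (hv : seqVal q c = 1) (hcoinf : ∀ j, ∃ i, c (j + i) ≠ N) (n : ℕ) :
    ∀ᶠ p in 𝓝 q, q ≤ p → ∃ d, IsExpansionOf p 1 d ∧ ∀ i < n, d i = c i := by
  have hN' : (1 : ℝ) ≤ N := by exact_mod_cast hN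
  have hq : 1 < q := by linarith
  have hs := seqVal_split hq hc n
  have hnn := seqVal_nonneg (c := fun i => c (n + i)) hq
  have hlt := seqVal_lt hq (fun i => hc (n + i)) (hcoinf n)
  have hlow : ∑ i ∈ Finset.range n, (c i : ℝ) / q ^ (i + 1) ≤ 1 := by
    have : 0 ≤ seqVal q (fun i => c (n + i)) / q ^ n := by positivity
    linarith
  have hhigh : 1 < ∑ i ∈ Finset.range n, (c i : ℝ) / q ^ (i + 1) + N / (q - 1) / q ^ n := by
    have : seqVal q (fun i => c (n + i)) / q ^ n < N / (q - 1) / q ^ n := by gcongr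
    linarith
  filter_upwards [lt_mem_nhds h1, gt_mem_nhds h2,
    ((continuousAt_prefix_sum (by linarith) c n).add
      (continuousAt_max_tail hq N n)).eventually_const_lt hhigh] with p hp1 hp2 hp3 hpq
  have hq0 : 0 < q := by linarith
  refine exists_expansion_of_prefix hN hp1 hp2.le hc (le_trans ?_ hlow) hp3.le
  gcongr

lemma eventually_notMem_of_prefixes {R : ℝ → Prop} {a b : ℕ → ℕ} (hab : a ≠ b)
    (ha : ∀ n, ∀ᶠ p in 𝓝 q, R p → ∃ d, IsExpansionOf p 1 d ∧ ∀ i < n, d i = a i)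
    (hb : ∀ n, ∀ᶠ p in 𝓝 q, R p → ∃ d, IsExpansionOf p 1 d ∧ ∀ i < n, d i = b i) :
    ∀ᶠ p in 𝓝 q, R p → p ∉ USet := by
  obtain ⟨n, hn⟩ := Function.ne_iff.1 hab
  filter_upwards [ha (n + 1), hb (n + 1)] with p hpa hpb hR hU
  obtain ⟨d, hd, hda⟩ := hpa hR
  obtain ⟨e, he, heb⟩ := hpb hR
  apply hn
  rw [← hda n n.lt_succ_self, ← heb n n.lt_succ_self, hU.2.unique hd he]

/-- If some expansion of `1` ends with the largest digit forever, then reflecting expansions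
of `1` turns infinitely many nonzero digits into infinitely many nonmaximal ones. -/
lemma exists_reflected_expansion (hN : 1 ≤ N) (h1 : (N : ℝ) < q) (h2 : q < N + 1)
    {b : ℕ → ℕ} (hb : ∀ i, b i ≤ N) (hbv : seqVal q b = 1) (hend : ∃ j, ∀ i, b (j + i) = N) :
    ∃ n, ∃ e : ℕ → ℕ, ∀ d : ℕ → ℕ, (∀ i, d i ≤ N) → seqVal q d = 1 →
      ∃ d' : ℕ → ℕ, (∀ i, d' i ≤ N) ∧ seqVal q d' = 1 ∧ (∀ i < n, d' i = e i) ∧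
        ∀ i, d' (n + i) = N - d i := by
  have hN' : (1 : ℝ) ≤ N := by exact_mod_cast hN
  have hq : 1 < q := by linarith
  have hconst : ∀ k, (∀ i, b (k + i) = N) → seqVal q (fun i => b (k + i)) = N / (q - 1) := by
    intro k hk
    simp only [hk]
    exact (hasSum_const_div_pow hq (N : ℝ)).tsum_eq
  obtain ⟨j, hj, hmin⟩ : ∃ j, (∀ i, b (j + i) = N) ∧ ∀ k < j, ¬ ∀ i, b (k + i) = N :=
    ⟨Nat.find hend, Nat.find_spec hend, fun k hk => Nat.find_min hend hk⟩
  obtain _ | n := j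
  · have h := hconst 0 hj
    simp only [zero_add, hbv] at h
    rw [eq_div_iff (by linarith)] at h
    linarith
  have hbn : b n < N := by
    refine lt_of_le_of_ne (hb n) fun hn => hmin n n.lt_succ_self fun i => ?_
    obtain _ | i := i
    · exact hn
    · rw [← hj i]
      congr 1
      ring
  refine ⟨n + 1, splice b n (b n + 1) fun _ => 0, fun d hd hdv =>
    ⟨splice b n (b n + 1) fun i => N - d i, ?_, ?_, ?_, fun i => splice_tail i⟩⟩
  · exact splice_le hb hbn fun i => Nat.sub_le _ _
  · refine seqVal_splice hq hb hbn (fun i => Nat.sub_le _ _) ?_ |>.trans hbv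
    rw [seqVal_compl hq hd, hconst _ hj, hdv]
    push_cast
    ring
  · intro i hi
    rcases Nat.lt_succ_iff_lt_or_eq.1 hi with h | rfl
    · rw [splice_of_lt h, splice_of_lt h]
    · rw [splice_self, splice_self]

lemma exists_coinfinite_pair (hN : 1 ≤ N) (h1 : (N : ℝ) < q) (h2 : q < N + 1) {a b : ℕ → ℕ}
    (ha : ∀ i, a i ≤ N) (hav : seqVal q a = 1) (hainf : ∀ j, ∃ i, a (j + i) ≠ 0)
    (hb : ∀ i, b i ≤ N) (hbv : seqVal q b = 1) (hbinf : ∀ j, ∃ i, b (j + i) ≠ 0) (hab : a ≠ b) :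
    ∃ a' b' : ℕ → ℕ, a' ≠ b' ∧
      ((∀ i, a' i ≤ N) ∧ seqVal q a' = 1 ∧ ∀ j, ∃ i, a' (j + i) ≠ N) ∧
      ((∀ i, b' i ≤ N) ∧ seqVal q b' = 1 ∧ ∀ j, ∃ i, b' (j + i) ≠ N) := by
  by_cases hend : ∃ c : ℕ → ℕ, (∀ i, c i ≤ N) ∧ seqVal q c = 1 ∧ ∃ j, ∀ i, c (j + i) = N
  · obtain ⟨c, hc, hcv, hce⟩ := hend
    obtain ⟨n, e, hP⟩ := exists_reflected_expansion hN h1 h2 hc hcv hce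
    have hco : ∀ d d' : ℕ → ℕ, (∀ i, d i ≤ N) → (∀ i, d' (n + i) = N - d i) →
        (∀ j, ∃ i, d (j + i) ≠ 0) → ∀ j, ∃ i, d' (j + i) ≠ N := by
      intro d d' hd hdd' hinf j
      obtain ⟨i, hi⟩ := hinf j
      refine ⟨n + i, ?_⟩
      rw [show j + (n + i) = n + (j + i) by ring, hdd']
      have := hd (j + i)
      omega
    obtain ⟨a', ha', hav', -, haa'⟩ := hP a ha hav
    obtain ⟨b', hb', hbv', -, hbb'⟩ := hP b hb hbv
    refine ⟨a', b', ?_, ⟨ha', hav', hco a a' ha haa' hainf⟩, ⟨hb', hbv', hco b b' hb hbb' hbinf⟩⟩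
    rintro rfl
    refine hab (funext fun i => ?_)
    have := haa' i
    have := hbb' i
    have := ha i
    have := hb i
    omega
  · push Not at hend
    exact ⟨a, b, hab, ⟨ha, hav, hend a ha hav⟩, hb, hbv, hend b hb hbv⟩

lemma unique_infinite_expansion_of_mem_closure (hq : 1 < q) (hU : q ∈ closure USet) :
    ∃! c, IsExpansionOf q 1 c ∧ InfiniteSeq c := by
  obtain ⟨hN, h1, h2⟩ := alphaOne_bounds hq
  refine existsUnique_of_exists_of_unique (exists_infinite_expansion hq) ?_
  rintro a b ⟨ha, hai⟩ ⟨hb, hbi⟩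
  obtain ⟨ha, hav⟩ := isExpansionOf_iff.1 ha
  obtain ⟨hb, hbv⟩ := isExpansionOf_iff.1 hb
  rw [infiniteSeq_iff] at hai hbi
  rcases h2.eq_or_lt with h2 | h2
  · rw [eq_const_of_seqVal_eq_one hq h2 ha hav, eq_const_of_seqVal_eq_one hq h2 hb hbv]
  by_contra hab
  obtain ⟨a', b', hab', ⟨ha', hav', hai'⟩, hb', hbv', hbi'⟩ :=
    exists_coinfinite_pair hN h1 h2 ha hav hai hb hbv hbi hab
  have hl := eventually_notMem_of_prefixes hab
    (eventually_exists_prefix_left hN h1 h2 ha hav hai)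
    (eventually_exists_prefix_left hN h1 h2 hb hbv hbi)
  have hr := eventually_notMem_of_prefixes hab'
    (eventually_exists_prefix_right hN h1 h2 ha' hav' hai')
    (eventually_exists_prefix_right hN h1 h2 hb' hbv' hbi')
  obtain ⟨p, hp, hpl, hpr⟩ := ((mem_closure_iff_frequently.1 hU).and_eventually (hl.and hr)).exists
  exact (le_total p q).elim (fun h => hpl h hp) (fun h => hpr h hp)

end Perturbation

/-- The first position where `α` shifted by `j` differs from the reflection of `α` is `l`, and
the shifted sequence is larger there. -/
def ExceedsReflection (N : ℕ) (α : ℕ → ℕ) (j l : ℕ) : Prop :=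
  (∀ i < l, α (j + i) + α i = N) ∧ N < α (j + l) + α l

lemma exists_first_ne {a b : ℕ → ℕ} (h : a ≠ b) : ∃ n, (∀ i < n, a i = b i) ∧ a n ≠ b n := by
  have h := Function.ne_iff.1 h
  exact ⟨Nat.find h, fun i hi => not_not.1 (Nat.find_min h hi), Nat.find_spec h⟩

section UniqueInfinite

variable {q : ℝ} {N : ℕ} {α c : ℕ → ℕ}

lemma digit_eq_of_unique_infinite (hq : 1 < q) (h2 : q ≤ N + 1) (hα : ∀ i, α i ≤ N)
    (hv : seqVal q α = 1)
    (huniq : ∀ c : ℕ → ℕ, (∀ i, c i ≤ N) → seqVal q c = 1 → (∀ j, ∃ i, c (j + i) ≠ 0) → c = α)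
    {n d : ℕ} {y : ℝ} (hd : d ≤ N) (hy0 : 0 < y) (hy : y ≤ N / (q - 1))
    (h : d + y = α n + seqVal q (fun i => α (n + 1 + i))) : d = α n := by
  obtain ⟨e, he, rfl, hei⟩ := exists_infinite_digits hq h2 hy0 hy
  rw [← huniq (splice α n d e) (splice_le hα hd he) ((seqVal_splice hq hα hd he h).trans hv)
    (splice_infinite hei), splice_self]

lemma tail_le_one_of_lt (hq : 1 < q) (h2 : q ≤ N + 1) (hα : ∀ i, α i ≤ N)
    (hv : seqVal q α = 1)
    (huniq : ∀ c : ℕ → ℕ, (∀ i, c i ≤ N) → seqVal q c = 1 → (∀ j, ∃ i, c (j + i) ≠ 0) → c = α)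
    {n : ℕ} (hn : α n < N) : seqVal q (fun i => α (n + 1 + i)) ≤ 1 := by
  by_contra! h
  have hle := seqVal_le hq fun i => hα (n + 1 + i)
  have := digit_eq_of_unique_infinite hq h2 hα hv huniq (n := n) (d := α n + 1)
    (y := seqVal q (fun i => α (n + 1 + i)) - 1) hn (by linarith) (by linarith)
    (by push_cast; ring)
  omega

lemma tail_le_one (hq : 1 < q) (h2 : q ≤ N + 1) (hα : ∀ i, α i ≤ N)
    (hv : seqVal q α = 1)
    (huniq : ∀ c : ℕ → ℕ, (∀ i, c i ≤ N) → seqVal q c = 1 → (∀ j, ∃ i, c (j + i) ≠ 0) → c = α)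
    (j : ℕ) : seqVal q (fun i => α (j + i)) ≤ 1 := by
  induction j with
  | zero => simp [hv]
  | succ j ih =>
    rcases (hα j).lt_or_eq with h | h
    · exact tail_le_one_of_lt hq h2 hα hv huniq h
    · rw [seqVal_tail hq hα j, h]
      nlinarith

lemma first_digit_eq (hq : 1 < q) (h1 : (N : ℝ) < q) (h2 : q ≤ N + 1) (hα : ∀ i, α i ≤ N)
    (hv : seqVal q α = 1)
    (huniq : ∀ c : ℕ → ℕ, (∀ i, c i ≤ N) → seqVal q c = 1 → (∀ j, ∃ i, c (j + i) ≠ 0) → c = α) :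
    α 0 = N := by
  by_contra h
  have h0 : α 0 + 1 ≤ N := lt_of_le_of_ne (hα 0) h
  have h0' : (α 0 + 1 : ℝ) ≤ N := by exact_mod_cast h0
  have ht := tail_le_one hq h2 hα hv huniq 1
  have := seqVal_tail hq hα 0
  simp only [zero_add, hv] at this
  linarith

lemma compl_tail_lt_one (hq : 1 < q) (h1 : (N : ℝ) < q) (h2 : q ≤ N + 1) (hN : 1 ≤ N)
    (hα : ∀ i, α i ≤ N) (hv : seqVal q α = 1)
    (huniq : ∀ c : ℕ → ℕ, (∀ i, c i ≤ N) → seqVal q c = 1 → (∀ j, ∃ i, c (j + i) ≠ 0) → c = α)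
    (j : ℕ) : N / (q - 1) - seqVal q (fun i => α (j + 1 + i)) < 1 := by
  have hpos : ∀ j, 0 < α j → N / (q - 1) - seqVal q (fun i => α (j + 1 + i)) < 1 := by
    intro j hj
    by_contra! h
    have hnn := seqVal_nonneg (c := fun i => α (j + 1 + i)) hq
    have := digit_eq_of_unique_infinite hq h2 hα hv huniq (n := j) (d := α j - 1)
      (y := seqVal q (fun i => α (j + 1 + i)) + 1) ((Nat.sub_le _ _).trans (hα j))
      (by linarith) (by linarith) (by rw [Nat.cast_sub hj]; push_cast; ring)
    omega
  induction j with
  | zero => exact hpos 0 (by rw [first_digit_eq hq h1 h2 hα hv huniq]; omega)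
  | succ j ih =>
    rcases Nat.eq_zero_or_pos (α (j + 1)) with h | h
    · have hd : (N : ℝ) / (q - 1) * (q - 1) = N := div_mul_cancel₀ _ (by linarith)
      rw [seqVal_tail hq hα (j + 1), h]
      push_cast
      nlinarith
    · exact hpos _ h

lemma lexLt_of_seqVal (hq : 1 < q) (h2 : q ≤ N + 1) (hα : ∀ i, α i ≤ N) (hv : seqVal q α = 1)
    (huniq : ∀ c : ℕ → ℕ, (∀ i, c i ≤ N) → seqVal q c = 1 → (∀ j, ∃ i, c (j + i) ≠ 0) → c = α)
    (hc : ∀ i, c i ≤ N) (hcv : seqVal q c ≤ 1) (hne : c ≠ α)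
    (h : seqVal q c < 1 ∨ ∀ j, ∃ i, c (j + i) ≠ 0) : LexLt c α := by
  obtain ⟨n, hagree, hn⟩ := exists_first_ne hne
  refine ⟨n, hagree, lt_of_le_of_ne ?_ hn⟩
  by_contra! hlt
  have ht := tail_le_one_of_lt hq h2 hα hv huniq (hlt.trans_le (hc n))
  have hs := seqVal_sub_of_agree hq hc hα hagree
  have hlt' : (α n + 1 : ℝ) ≤ c n := by exact_mod_cast hlt
  have hqn : 0 < q ^ (n + 1) := by positivity
  rw [hv] at hs
  rcases h with h | h
  · have := seqVal_nonneg (c := fun i => c (n + 1 + i)) hq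
    nlinarith
  · have := seqVal_pos hq (fun i => hc (n + 1 + i)) (h (n + 1))
    nlinarith

lemma lexLe_tail (hq : 1 < q) (h2 : q ≤ N + 1) (hα : ∀ i, α i ≤ N) (hv : seqVal q α = 1)
    (huniq : ∀ c : ℕ → ℕ, (∀ i, c i ≤ N) → seqVal q c = 1 → (∀ j, ∃ i, c (j + i) ≠ 0) → c = α)
    (hinf : ∀ j, ∃ i, α (j + i) ≠ 0) (j : ℕ) : LexLe (fun i => α (j + i)) α := by
  by_cases h : (fun i => α (j + i)) = α
  · exact Or.inr h
  · refine Or.inl (lexLt_of_seqVal hq h2 hα hv huniq (fun i => hα _)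
      (tail_le_one hq h2 hα hv huniq j) h (Or.inr fun k => ?_))
    simpa only [add_assoc] using hinf (j + k)

lemma exists_exceedsReflection (hq : 1 < q) (h1 : (N : ℝ) < q) (h2 : q ≤ N + 1) (hN : 1 ≤ N)
    (hα : ∀ i, α i ≤ N) (hv : seqVal q α = 1)
    (huniq : ∀ c : ℕ → ℕ, (∀ i, c i ≤ N) → seqVal q c = 1 → (∀ j, ∃ i, c (j + i) ≠ 0) → c = α)
    (j : ℕ) : ∃ l, ExceedsReflection N α j l := by
  obtain _ | j := j
  · refine ⟨0, by simp, ?_⟩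
    simp only [add_zero, first_digit_eq hq h1 h2 hα hv huniq]
    omega
  · have hlt := compl_tail_lt_one hq h1 h2 hN hα hv huniq j
    rw [← seqVal_compl hq fun i => hα (j + 1 + i)] at hlt
    obtain ⟨l, hl, hl'⟩ := lexLt_of_seqVal hq h2 hα hv huniq (c := fun i => N - α (j + 1 + i))
      (fun i => Nat.sub_le _ _) hlt.le (by rintro h; rw [h, hv] at hlt; exact hlt.false)
      (Or.inl hlt)
    refine ⟨l, fun i hi => ?_, ?_⟩
    · have h := hl i hi
      have := hα (j + 1 + i)
      simp only at h
      omega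
    · simp only at hl'
      omega

lemma exists_period (hq : 1 < q)
    (hα : ∀ i, α i ≤ N) (hv : seqVal q α = 1) (hinf : ∀ j, ∃ i, α (j + i) ≠ 0)
    (huniq : ∀ c : ℕ → ℕ, (∀ i, c i ≤ N) → seqVal q c = 1 → (∀ j, ∃ i, c (j + i) ≠ 0) → c = α)
    (hc : ∀ i, c i ≤ N) (hcv : seqVal q c = 1) (hne : c ≠ α) :
    ∃ k, Function.Periodic α (k + 1) := by
  have hfin : ∃ j, ∀ i, c (j + i) = 0 := by
    by_contra! h
    exact hne (huniq c hc hcv h)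
  obtain ⟨j, hj, hmin⟩ : ∃ j, (∀ i, c (j + i) = 0) ∧ ∀ k < j, ¬ ∀ i, c (k + i) = 0 :=
    ⟨Nat.find hfin, Nat.find_spec hfin, fun k hk => Nat.find_min hfin hk⟩
  obtain _ | k := j
  · simp only [zero_add] at hj
    simp [seqVal, hj] at hcv
  have hk : 1 ≤ c k := by
    refine Nat.one_le_iff_ne_zero.2 fun h => hmin k k.lt_succ_self fun i => ?_
    obtain _ | i := i
    · exact h
    · rw [← hj i]
      congr 1
      ring
  have hs := huniq (splice c k (c k - 1) α) (splice_le hc ((Nat.sub_le _ _).trans (hc k)) hα)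
    ((seqVal_splice hq hc ((Nat.sub_le _ _).trans (hc k)) hα ?_).trans hcv) (splice_infinite hinf)
  · refine ⟨k, fun i => ?_⟩
    rw [← splice_tail (b := c) (n := k) (d := c k - 1) (e := α) i, hs, add_comm]
  · have h0 : seqVal q (fun i => c (k + 1 + i)) = 0 := by simp [seqVal, hj]
    rw [hv, h0, Nat.cast_sub hk]
    push_cast
    ring

end UniqueInfinite

section Blocks

variable {N L : ℕ} {α : ℕ → ℕ}

lemma exists_uniform_exceedsReflection {k : ℕ} (hk : Function.Periodic α (k + 1))
    (h : ∀ j, ∃ l, ExceedsReflection N α j l) :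
    ∃ L, ∀ j, ∃ l < L, ExceedsReflection N α j l := by
  choose l hl using h
  refine ⟨(Finset.range (k + 1)).sup l + 1, fun j => ⟨l (j % (k + 1)), ?_, ?_⟩⟩
  · exact Nat.lt_succ_of_le
      (Finset.le_sup (f := l) (Finset.mem_range.2 (Nat.mod_lt j k.succ_pos)))
  · have hmod : ∀ i, α (j + i) = α (j % (k + 1) + i) := by
      intro i
      rw [← hk.map_mod_nat (j + i), ← hk.map_mod_nat (j % (k + 1) + i), Nat.mod_add_mod]
    have := hl (j % (k + 1))
    simp only [ExceedsReflection, hmod] at this ⊢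
    simpa using this

/-- Every suffix of the first `m` digits of `α` exceeds the reflection of `α` within the block. -/
def GoodBlock (N : ℕ) (α : ℕ → ℕ) (L m : ℕ) : Prop :=
  ∀ j < m, ∃ l < L, j + l < m ∧ ExceedsReflection N α j l

lemma exists_goodBlock (hT : ∀ j, LexLe (fun i => α (j + i)) α)
    (hE : ∀ j, ∃ l < L, ExceedsReflection N α j l) (j₀ : ℕ) : ∃ m > j₀, GoodBlock N α L m := by
  choose l hlL hl using hE
  obtain ⟨J, hJ, hmax⟩ := (Finset.range (j₀ + 1)).exists_max_image (fun j => j + l j) ⟨0, by simp⟩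
  simp only [Finset.mem_range] at hJ hmax
  refine ⟨J + l J + 1, ?_, fun j hj => ?_⟩
  · have := hmax j₀ (by omega)
    omega
  rcases Nat.lt_or_ge j (j₀ + 1) with h | h
  · exact ⟨l j, hlL j, Nat.lt_succ_of_le (hmax j h), hl j⟩
  obtain ⟨t, rfl⟩ : ∃ t, j = J + t := ⟨j - J, by omega⟩
  have ht : t ≤ l J := by omega
  have hlJ := hlL J
  have hend : (∀ i < l J - t, α (t + i) = α i) → α (l J) ≤ α (l J - t) →
      ExceedsReflection N α (J + t) (l J - t) := by
    intro hag hle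
    refine ⟨fun i hi => ?_, ?_⟩
    · rw [← hag i hi, add_assoc]
      exact (hl J).1 _ (by omega)
    · have := (hl J).2
      rw [show J + t + (l J - t) = J + l J by omega]
      omega
  rcases hT t with ⟨u, hu, hu'⟩ | hu
  · rcases Nat.lt_or_ge u (l J - t) with hlt | hge
    · refine ⟨u, by omega, by omega, fun i hi => ?_, ?_⟩
      · rw [← hu i hi, add_assoc]
        exact (hl J).1 _ (by omega)
      · have := (hl J).1 (t + u) (by omega)
        rw [← add_assoc] at this
        dsimp only at hu'
        omega
    · refine ⟨l J - t, by omega, by omega, hend (fun i hi => hu i (by omega)) ?_⟩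
      rcases hge.eq_or_lt with h' | h'
      · simp only [h'.symm, show t + (l J - t) = l J by omega] at hu'
        exact hu'.le
      · have := hu _ h'
        simp only [show t + (l J - t) = l J by omega] at this
        exact this.le
  · have hu := fun i => congrFun hu i
    refine ⟨l J - t, by omega, by omega, hend (fun i hi => hu i) ?_⟩
    have := hu (l J - t)
    simp only [show t + (l J - t) = l J by omega] at this
    exact this.le

/-- A sequence that finishes a good block of `α`, with its last digit lowered by one, and then
follows `α` again lies strictly between the reflection of `γ` and `γ`, if `γ` agrees with `α`
for long enough. -/
lemma lexLt_of_block {c γ : ℕ → ℕ} {j t s M : ℕ} (hT : ∀ j, LexLe (fun i => α (j + i)) α)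
    (hE : ∀ j, ∃ l < L, ExceedsReflection N α j l)
    (hgood : ∃ l < L, l ≤ t ∧ ExceedsReflection N α j l) (hcN : ∀ i, c i ≤ N)
    (hc : ∀ i < t, c i = α (j + i)) (hct : c t + 1 = α (j + t))
    (hcs : ∀ i, i + 1 < s → c (t + 1 + i) = α i) (hγ : ∀ i, i + 1 < M → γ i = α i)
    (hs : L < s) (hM : 2 * L < M) (htM : t + 1 < M) :
    LexLt c γ ∧ LexLt (fun i => N - c i) γ := by
  constructor
  · have hend : (∀ i < t, α (j + i) = α i) → α (j + t) ≤ α t → LexLt c γ := by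
      intro hag hle
      refine ⟨t, fun i hi => ?_, ?_⟩
      · rw [hc i hi, hγ i (by omega), hag i hi]
      · rw [hγ t htM]
        omega
    rcases hT j with ⟨u, hu, hu'⟩ | hu
    · rcases Nat.lt_trichotomy u t with h | h | h
      · refine ⟨u, fun i hi => ?_, ?_⟩
        · rw [hc i (by omega), hγ i (by omega)]
          exact hu i hi
        · rw [hc u h, hγ u (by omega)]
          exact hu'
      · subst h
        exact hend hu hu'.le
      · exact hend (fun i hi => hu i (by omega)) (hu t h).le
    · exact hend (fun i _ => congrFun hu i) (congrFun hu t).le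
  · obtain ⟨l, hlL, hlt, hl, hl'⟩ := hgood
    rcases hlt.lt_or_eq with h | rfl
    · refine ⟨l, fun i hi => ?_, ?_⟩
      · simp only [hc i (by omega), hγ i (by omega)]
        have := hl i hi
        omega
      · have := hcN l
        simp only [hc l h, hγ l (by omega)] at this ⊢
        omega
    have hbefore : ∀ i < l, N - c i = γ i := by
      intro i hi
      have := hl i hi
      rw [hc i hi, hγ i (by omega)]
      omega
    rcases Nat.lt_or_ge N (c l + α l) with h | h
    · refine ⟨l, hbefore, ?_⟩
      simp only [hγ l htM]
      have := hcN l
      omega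
    · obtain ⟨k, hkL, hk, hk'⟩ := hE (l + 1)
      refine ⟨l + 1 + k, fun i hi => ?_, ?_⟩
      · rcases Nat.lt_trichotomy i l with h' | rfl | h'
        · exact hbefore i h'
        · simp only [hγ i htM]
          omega
        · obtain ⟨i, rfl⟩ : ∃ i', i = l + 1 + i' := ⟨i - (l + 1), by omega⟩
          simp only [hcs i (by omega), hγ (l + 1 + i) (by omega)]
          have := hk i (by omega)
          omega
      · have := hcN (l + 1 + k)
        simp only [hcs k (by omega), hγ (l + 1 + k) (by omega)] at this ⊢
        omega

/-- The first `s` digits of `α`, the last one lowered by one, repeated periodically. -/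
def loweredPeriodic (α : ℕ → ℕ) (s i : ℕ) : ℕ :=
  if i % s = s - 1 then α (s - 1) - 1 else α (i % s)

/-- The first `M` digits of `α`, the last one lowered by one, followed by
`loweredPeriodic α s`. -/
def loweredApprox (α : ℕ → ℕ) (M s : ℕ) : ℕ → ℕ :=
  splice α (M - 1) (α (M - 1) - 1) (loweredPeriodic α s)

lemma loweredApprox_le {M s : ℕ} (hα : ∀ i, α i ≤ N) (i : ℕ) : loweredApprox α M s i ≤ N := by
  refine splice_le hα ((Nat.sub_le _ _).trans (hα _)) (fun i => ?_) i
  unfold loweredPeriodic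
  split_ifs
  exacts [(Nat.sub_le _ _).trans (hα _), hα _]

lemma last_pos_of_goodBlock {m : ℕ} (hα : ∀ i, α i ≤ N) (h : GoodBlock N α L (m + 1)) :
    1 ≤ α m := by
  obtain ⟨l, -, hl, -, hl'⟩ := h m m.lt_succ_self
  obtain rfl : l = 0 := by omega
  have := hα 0
  simp only [add_zero] at hl'
  omega

lemma loweredApprox_lexLt {M s : ℕ} (hα : ∀ i, α i ≤ N) (hT : ∀ j, LexLe (fun i => α (j + i)) α)
    (hE : ∀ j, ∃ l < L, ExceedsReflection N α j l) (hs : GoodBlock N α L s)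
    (hMg : GoodBlock N α L M) (hLs : L < s) (hsM : s < M) (hLM : 2 * L < M) (j : ℕ) :
    LexLt (fun i => loweredApprox α M s (j + 1 + i)) (loweredApprox α M s) ∧
      LexLt (fun i => N - loweredApprox α M s (j + 1 + i)) (loweredApprox α M s) := by
  obtain ⟨M, rfl⟩ : ∃ M', M = M' + 1 := ⟨M - 1, by omega⟩
  obtain ⟨s, rfl⟩ : ∃ s', s = s' + 1 := ⟨s - 1, by omega⟩
  have hγ : ∀ i, i + 1 < M + 1 → loweredApprox α (M + 1) (s + 1) i = α i :=
    fun i hi => splice_of_lt (by simpa using hi)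
  have hγM : loweredApprox α (M + 1) (s + 1) M = α M - 1 := splice_self
  have hγt : ∀ i, loweredApprox α (M + 1) (s + 1) (M + 1 + i) = loweredPeriodic α (s + 1) i :=
    fun i => splice_tail i
  have hδ : ∀ k i, i < s → loweredPeriodic α (s + 1) ((s + 1) * k + i) = α i := by
    intro k i hi
    rw [loweredPeriodic, Nat.mul_add_mod, Nat.mod_eq_of_lt (by omega), if_neg (by omega)]
  have hδs : ∀ k, loweredPeriodic α (s + 1) ((s + 1) * k + s) = α s - 1 := by
    intro k
    rw [loweredPeriodic, Nat.mul_add_mod, Nat.mod_eq_of_lt (by omega), if_pos (by omega)]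
    rfl
  have hMpos := last_pos_of_goodBlock hα hMg
  have hspos := last_pos_of_goodBlock hα hs
  rcases Nat.lt_or_ge j M with hj | hj
  · obtain ⟨l, hlL, hlM, hl⟩ := hMg (j + 1) (by omega)
    refine lexLt_of_block (s := s + 1) (t := M - (j + 1)) hT hE ⟨l, hlL, by omega, hl⟩
      (fun i => loweredApprox_le hα _) (fun i hi => hγ _ (by omega)) ?_ (fun i hi => ?_) hγ hLs hLM
      (by omega)
    · rw [show j + 1 + (M - (j + 1)) = M by omega, hγM]
      omega
    · have := hδ 0 i (by omega)
      rw [mul_zero, zero_add] at this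
      rw [← this, ← hγt]
      congr 1
      omega
  · obtain ⟨j, rfl⟩ : ∃ j', j = M + j' := ⟨j - M, by omega⟩
    have hdiv := Nat.div_add_mod j (s + 1)
    have hmod := Nat.mod_lt j (Nat.succ_pos s)
    set k := j / (s + 1)
    set r := j % (s + 1)
    have hshift : ∀ i, loweredApprox α (M + 1) (s + 1) (M + j + 1 + i) =
        loweredPeriodic α (s + 1) ((s + 1) * k + (r + i)) := by
      intro i
      rw [← hγt]
      congr 1
      omega
    obtain ⟨l, hlL, hlM, hl⟩ := hs r hmod
    refine lexLt_of_block (s := s + 1) (t := s - r) hT hE ⟨l, hlL, by omega, hl⟩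
      (fun i => loweredApprox_le hα _) (fun i hi => ?_) ?_ (fun i hi => ?_) hγ hLs hLM
      (by omega)
    · rw [hshift, hδ _ _ (by omega)]
    · rw [hshift, show r + (s - r) = s by omega, hδs]
      omega
    · rw [hshift, ← hδ (k + 1) i (by omega)]
      congr 1
      rw [mul_add]
      omega

end Blocks

section Univoque

variable {p : ℝ} {N : ℕ} {γ c : ℕ → ℕ}

lemma seqVal_lt_one_of_lexLt (hp : 1 < p) (hγ : ∀ i, γ i ≤ N) (hv : seqVal p γ = 1)
    (hpos : ∀ j, 0 < seqVal p (fun i => γ (j + 1 + i))) (hc : ∀ i, c i ≤ N)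
    (h : ∀ j, LexLt (fun i => c (j + i)) γ) : seqVal p c < 1 := by
  have step : ∀ j, ∃ l k, p ^ (l + 1) * (seqVal p (fun i => c (j + i)) - 1) <
      seqVal p (fun i => c (k + i)) - 1 := by
    intro j
    obtain ⟨l, hl, hl'⟩ := h j
    have hs := seqVal_sub_of_agree hp (fun i => hc (j + i)) hγ hl
    have hl'' : (c (j + l) + 1 : ℝ) ≤ γ l := by exact_mod_cast hl'
    have := hpos l
    refine ⟨l, j + (l + 1), ?_⟩
    rw [hv] at hs
    simp only [add_assoc j] at hs ⊢
    rw [hs]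
    linarith
  have hbound : ∀ n j, seqVal p (fun i => c (j + i)) - 1 ≤ N / (p - 1) / p ^ n := by
    have hC : 0 ≤ (N : ℝ) / (p - 1) := div_nonneg (by positivity) (by linarith)
    intro n
    induction n with
    | zero =>
      intro j
      have := seqVal_le hp fun i => hc (j + i)
      simp only [pow_zero, div_one]
      linarith
    | succ n ih =>
      intro j
      rcases le_total (seqVal p (fun i => c (j + i)) - 1) 0 with h0 | h0
      · exact h0.trans (by positivity)
      · obtain ⟨l, k, hlk⟩ := step j
        have hpl : p ≤ p ^ (l + 1) := le_self_pow₀ hp.le (by omega)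
        have h1 : p * (seqVal p (fun i => c (j + i)) - 1) ≤ N / (p - 1) / p ^ n :=
          (mul_le_mul_of_nonneg_right hpl h0).trans (hlk.le.trans (ih k))
        rw [pow_succ, ← div_div, le_div_iff₀ (by linarith)]
        linarith
  have hle : ∀ j, seqVal p (fun i => c (j + i)) - 1 ≤ 0 := fun j =>
    ge_of_tendsto' (tendsto_const_nhds.div_atTop (tendsto_pow_atTop_atTop_of_one_lt hp))
      fun n => hbound n j
  obtain ⟨l, k, hlk⟩ := step 0
  simp only [zero_add] at hlk
  have := hlk.trans_le (hle k)
  have hpl : 0 < p ^ (l + 1) := by positivity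
  by_contra! hge
  nlinarith

lemma mem_USet_of_lexLt (hp : 1 < p) (h1 : (N : ℝ) < p) (h2 : p ≤ N + 1)
    (hγ : ∀ i, γ i ≤ N) (hv : seqVal p γ = 1)
    (hlt : ∀ j, LexLt (fun i => γ (j + 1 + i)) γ)
    (hlt' : ∀ j, LexLt (fun i => N - γ (j + 1 + i)) γ) : p ∈ USet := by
  have hpos : ∀ j, 0 < seqVal p (fun i => γ (j + 1 + i)) := by
    intro j
    obtain ⟨n, -, hn⟩ := hlt' j
    refine seqVal_pos hp (fun i => hγ _) ⟨n, fun h => ?_⟩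
    have := hγ n
    simp only [h] at hn
    omega
  have hval : ∀ j, seqVal p (fun i => γ (j + 1 + i)) < 1 := by
    intro j
    refine seqVal_lt_one_of_lexLt hp hγ hv hpos (fun i => hγ _) fun k => ?_
    simpa only [show ∀ i, j + 1 + (k + i) = j + k + 1 + i from fun i => by ring]
      using hlt (j + k)
  have hval' : ∀ j, N / (p - 1) - seqVal p (fun i => γ (j + 1 + i)) < 1 := by
    intro j
    rw [← seqVal_compl hp fun i => hγ (j + 1 + i)]
    refine seqVal_lt_one_of_lexLt hp hγ hv hpos (fun i => Nat.sub_le _ _) fun k => ?_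
    simpa only [show ∀ i, j + 1 + (k + i) = j + k + 1 + i from fun i => by ring]
      using hlt' (j + k)
  have hN := alphaOne_eq h1 h2
  refine ⟨hp, γ, isExpansionOf_iff.2 ⟨by rwa [hN], hv⟩, fun d hd => ?_⟩
  obtain ⟨hd, hdv⟩ := isExpansionOf_iff.1 hd
  rw [hN] at hd
  by_contra hne
  obtain ⟨n, hag, hn⟩ := exists_first_ne hne
  have hs := seqVal_sub_of_agree hp hd hγ hag
  rw [hdv, hv, sub_self, mul_zero] at hs
  rcases hn.lt_or_gt with hn | hn
  · have hn' : (d n + 1 : ℝ) ≤ γ n := by exact_mod_cast hn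
    have := seqVal_le hp fun i => hd (n + 1 + i)
    linarith [hval' n]
  · have hn' : (γ n + 1 : ℝ) ≤ d n := by exact_mod_cast hn
    have := seqVal_nonneg (c := fun i => d (n + 1 + i)) hp
    linarith [hval n]

end Univoque

section Approximation

open Filter Topology

variable {N : ℕ} {α c : ℕ → ℕ}

lemma seqVal_strictAnti {x y : ℝ} (hx : 1 < x) (hxy : x < y) (hc : ∀ i, c i ≤ N)
    (h0 : 0 < c 0) : seqVal y c < seqVal x c := by
  have hx0 : 0 < x := by linarith
  refine Summable.tsum_lt_tsum (i := 0) (fun i => ?_) ?_ (summable_digits (hx.trans hxy) hc)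
    (summable_digits hx hc)
  · gcongr
  · have : (0 : ℝ) < c 0 := by exact_mod_cast h0
    simp only [zero_add, pow_one]
    gcongr

lemma continuousOn_seqVal {x : ℝ} (hx : 1 < x) (hc : ∀ i, c i ≤ N) :
    ContinuousOn (fun p => seqVal p c) (Set.Ici x) := by
  refine continuousOn_tsum (u := fun i => (N : ℝ) / x ^ (i + 1)) (fun i => ?_)
    (hasSum_const_div_pow hx _).summable fun i p hp => ?_
  · refine continuousOn_const.div (continuousOn_id.pow _) fun p hp => ?_
    have : 0 < p := by linarith [Set.mem_Ici.1 hp]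
    exact (pow_pos this (i + 1)).ne'
  · have hp : x ≤ p := hp
    have hp0 : 0 < p := by linarith
    have : (c i : ℝ) ≤ N := by exact_mod_cast hc i
    rw [Real.norm_of_nonneg (by positivity)]
    gcongr

lemma tendsto_seqVal {x : ℝ} (hx : 1 < x) {u : ℕ → ℕ → ℕ} (hu : ∀ n i, u n i ≤ N)
    (h : ∀ n, ∀ i < n, u n i = α i) :
    Tendsto (fun n => seqVal x (u n)) atTop (𝓝 (seqVal x α)) := by
  refine tendsto_tsum_of_dominated_convergence (bound := fun i => (N : ℝ) / x ^ (i + 1))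
    (hasSum_const_div_pow hx _).summable (fun i => ?_) (Eventually.of_forall fun n i => ?_)
  · refine tendsto_const_nhds.congr' ?_
    filter_upwards [eventually_gt_atTop i] with n hn
    rw [h n i hn]
  · have hp0 : 0 < x := by linarith
    have : (u n i : ℝ) ≤ N := by exact_mod_cast hu n i
    rw [Real.norm_of_nonneg (by positivity)]
    gcongr

lemma mem_closure_of_unique_infinite_expansion {q : ℝ} (hq : 1 < q)
    (hex : ∃! c, IsExpansionOf q 1 c ∧ InfiniteSeq c) : q ∈ closure USet := by
  obtain ⟨hN, h1, h2⟩ := alphaOne_bounds hq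
  by_cases hU : q ∈ USet
  · exact subset_closure hU
  obtain ⟨α, ⟨hexp, hinf⟩, huniq⟩ := hex
  obtain ⟨hα, hv⟩ := isExpansionOf_iff.1 hexp
  rw [infiniteSeq_iff] at hinf
  obtain ⟨c, hcexp, hne⟩ : ∃ c, IsExpansionOf q 1 c ∧ c ≠ α := by
    by_contra! h
    exact hU ⟨hq, α, hexp, h⟩
  obtain ⟨hc, hcv⟩ := isExpansionOf_iff.1 hcexp
  set N := alphaOne q
  replace huniq : ∀ c : ℕ → ℕ, (∀ i, c i ≤ N) → seqVal q c = 1 → (∀ j, ∃ i, c (j + i) ≠ 0) →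
      c = α := fun c h h' h'' => huniq c ⟨isExpansionOf_iff.2 ⟨h, h'⟩, infiniteSeq_iff.2 h''⟩
  have h2' : q < N + 1 := by
    refine h2.lt_of_ne fun h => hne ?_
    rw [eq_const_of_seqVal_eq_one hq h hα hv, eq_const_of_seqVal_eq_one hq h hc hcv]
  have hα0 : 0 < α 0 := by
    rw [first_digit_eq hq h1 h2 hα hv huniq]
    omega
  have hT := lexLe_tail hq h2 hα hv huniq hinf
  obtain ⟨k, hk⟩ := exists_period hq hα hv hinf huniq hc hcv hne
  obtain ⟨L, hE⟩ := exists_uniform_exceedsReflection hk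
    (exists_exceedsReflection hq h1 h2 hN hα hv huniq)
  obtain ⟨s, hLs, hs⟩ := exists_goodBlock hT hE L
  choose M hMgt hM using fun n => exists_goodBlock hT hE (n + s + 2 * L + 1)
  set u : ℕ → ℕ → ℕ := fun n => loweredApprox α (M n) s
  have huN : ∀ n i, u n i ≤ N := fun n i => loweredApprox_le hα i
  have huα : ∀ n, ∀ i < n, u n i = α i := fun n i hi =>
    splice_of_lt (by have := hMgt n; omega)
  refine Metric.mem_closure_iff.2 fun ε hε => ?_
  obtain ⟨x, hx, hxq⟩ := exists_between (show max (N : ℝ) (q - ε) < q from max_lt h1 (by linarith))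
  obtain ⟨y, hqy, hy⟩ := exists_between (show q < min ((N : ℝ) + 1) (q + ε) from
    lt_min h2' (by linarith))
  rw [max_lt_iff] at hx
  rw [lt_min_iff] at hy
  have hN' : (1 : ℝ) ≤ N := by exact_mod_cast hN
  have hx1 : 1 < x := by linarith
  have hy1 : 1 < y := by linarith
  have hvx : 1 < seqVal x α := hv ▸ seqVal_strictAnti hx1 hxq hα hα0
  have hvy : seqVal y α < 1 := hv ▸ seqVal_strictAnti hq hqy hα hα0
  obtain ⟨n, hnx, hny⟩ := (((tendsto_seqVal hx1 huN huα).eventually_const_lt hvx).and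
    ((tendsto_seqVal hy1 huN huα).eventually_lt_const hvy)).exists
  obtain ⟨p, ⟨hxp, hpy⟩, hpv⟩ := intermediate_value_Icc' (hxq.trans hqy).le
    ((continuousOn_seqVal hx1 (huN n)).mono Set.Icc_subset_Ici_self) ⟨hny.le, hnx.le⟩
  have hlex := loweredApprox_lexLt hα hT hE hs (hM n) hLs (by have := hMgt n; omega)
    (by have := hMgt n; omega)
  refine ⟨p, mem_USet_of_lexLt (by linarith) (by linarith) (by linarith) (huN n) hpv
    (fun j => (hlex j).1) (fun j => (hlex j).2), ?_⟩
  rw [Real.dist_eq, abs_lt]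
  constructor <;> linarith

end Approximation

/-- `q > 1` belongs to the closure of `U` iff `1` has a unique
infinite expansion in base `q`. -/
theorem mem_closure_univoque_iff_unique_infinite_expansion (q : ℝ) (hq : 1 < q) :
    q ∈ closure USet ↔ ∃! c, IsExpansionOf q 1 c ∧ InfiniteSeq c :=
  ⟨unique_infinite_expansion_of_mem_closure hq, mem_closure_of_unique_infinite_expansion hq⟩
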